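/- Let I = [0,1] with the Euclidean metric d₁ and let K be a compact metric space with metric d₂. Let G₀, G_δ : I × K → K be Borel measurable maps, let L ≥ 0 and R ≥ 0, and let γ, γ_δ ∈ I. Assume: (i) d₂(G₀(γ, y), G₀(γ_δ, y)) ≤ L · d₁(γ, γ_δ) for all y ∈ K; (ii) d₂(G₀(x, y), G_δ(x, y)) ≤ R for all (x,y) ∈ I × K; (iii) d₁(γ, γ_δ) ≤ R. Then for every finite Borel measure ν on K and every admissible test function h, |∫_K h(G₀(γ, y)) dν(y) − ∫_K h(G_δ(γ_δ, y)) dν(y)| ≤ R · (1 + L) · ν(K). Consequently the Wasserstein–Kantorovich norm of the difference of the pushforwards of ν under y ↦ G₀(γ,y) and y ↦ G_δ(γ_δ,y) is at most R(1 + L) ν(K). -/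

import Mathlib

open MeasureTheory

/-- Comparison of the fiber maps of an admissible `R(δ)`-perturbation:
if `G₀` is `L`-Lipschitz in the horizontal direction at `(γ, γ_δ)`, `G₀` and
`G_δ` are `R`-close in the sup distance, and `d₁(γ, γ_δ) ≤ R`, then for every
finite Borel measure `ν` on `K` and every admissible test function `h`,
`|∫ h(G₀(γ,y)) dν − ∫ h(G_δ(γ_δ,y)) dν| ≤ R (1 + L) ν(K)`; consequently the
Wasserstein–Kantorovich norm of the difference of the pushforwards of `ν`
under `y ↦ G₀(γ,y)` and `y ↦ G_δ(γ_δ,y)` is at most `R (1 + L) ν(K)`. -/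
theorem fiber_map_perturbation_WK
    {K : Type*} [MetricSpace K] [CompactSpace K] [MeasurableSpace K] [BorelSpace K]
    (G₀ Gδ : ℝ × K → K) (hG₀ : Measurable G₀) (hGδ : Measurable Gδ)
    (L R : ℝ) (hL : 0 ≤ L) (hR : 0 ≤ R)
    (γ γδ : ℝ) (hγ : γ ∈ Set.Icc (0:ℝ) 1) (hγδ : γδ ∈ Set.Icc (0:ℝ) 1)
    (hLip : ∀ y : K, dist (G₀ (γ, y)) (G₀ (γδ, y)) ≤ L * dist γ γδ)
    (hclose : ∀ x ∈ Set.Icc (0:ℝ) 1, ∀ y : K, dist (G₀ (x, y)) (Gδ (x, y)) ≤ R)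
    (hpre : dist γ γδ ≤ R)
    (ν : Measure K) [IsFiniteMeasure ν] :
    (∀ h : K → ℝ, LipschitzWith 1 h → (∀ x, |h x| ≤ 1) →
      |∫ y, h (G₀ (γ, y)) ∂ν - ∫ y, h (Gδ (γδ, y)) ∂ν|
        ≤ R * (1 + L) * (ν Set.univ).toReal) ∧
    sSup {r : ℝ | ∃ h : K → ℝ, LipschitzWith 1 h ∧ (∀ x, |h x| ≤ 1) ∧
        r = |∫ x, h x ∂(ν.map (fun y => G₀ (γ, y)))
              - ∫ x, h x ∂(ν.map (fun y => Gδ (γδ, y)))|}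
      ≤ R * (1 + L) * (ν Set.univ).toReal := by
  have m0 : Measurable (fun y => G₀ (γ, y)) := hG₀.comp measurable_prodMk_left
  have m1 : Measurable (fun y => Gδ (γδ, y)) := hGδ.comp measurable_prodMk_left
  have key : ∀ h : K → ℝ, LipschitzWith 1 h → (∀ x, |h x| ≤ 1) →
      |∫ y, h (G₀ (γ, y)) ∂ν - ∫ y, h (Gδ (γδ, y)) ∂ν|
        ≤ R * (1 + L) * (ν Set.univ).toReal := by
    intro h hl hb
    have hm : Measurable h := hl.continuous.measurable
    have i0 : Integrable (fun y => h (G₀ (γ, y))) ν :=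
      Integrable.of_bound (hm.comp m0).aestronglyMeasurable 1
        (Filter.Eventually.of_forall fun y => hb _)
    have i1 : Integrable (fun y => h (Gδ (γδ, y))) ν :=
      Integrable.of_bound (hm.comp m1).aestronglyMeasurable 1
        (Filter.Eventually.of_forall fun y => hb _)
    rw [← integral_sub i0 i1]
    rw [← Real.norm_eq_abs]
    refine norm_integral_le_of_norm_le_const (μ := ν) (Filter.Eventually.of_forall fun y => ?_)
    have h1 := hl.dist_le_mul (G₀ (γ, y)) (Gδ (γδ, y))
    rw [Real.dist_eq] at h1
    rw [Real.norm_eq_abs]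
    have h2 := dist_triangle (G₀ (γ, y)) (G₀ (γδ, y)) (Gδ (γδ, y))
    have h3 := hLip y
    have h4 := hclose γδ hγδ y
    have h5 := mul_le_mul_of_nonneg_left hpre hL
    simp only [NNReal.coe_one, one_mul] at h1
    linarith
  refine ⟨key, Real.sSup_le ?_ (by positivity)⟩
  rintro r ⟨h, hl, hb, rfl⟩
  rw [integral_map m0.aemeasurable hl.continuous.measurable.aestronglyMeasurable,
    integral_map m1.aemeasurable hl.continuous.measurable.aestronglyMeasurable]
  exact key h hl hb
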